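/- For every real x > 0, F(x) − F(x+1) − F(x/(x+1)) = −F(1) + Li₂(1/(1+x)). -/

import Mathlib

open Real

/-- The digamma function ψ = Γ′/Γ. -/
noncomputable def digamma (x : ℝ) : ℝ := deriv Real.Gamma x / Real.Gamma x

/-- The Herglotz function F(x) = ∑_{n≥1} (ψ(nx) − log(nx))/n. -/
noncomputable def herglotzF (x : ℝ) : ℝ :=
  ∑' n : ℕ, (digamma (((n : ℝ) + 1) * x) - Real.log (((n : ℝ) + 1) * x)) / ((n : ℝ) + 1)

/-- The dilogarithm Li₂(x) = ∑_{n≥1} xⁿ/n². -/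
noncomputable def Li2 (x : ℝ) : ℝ := ∑' n : ℕ, x ^ (n + 1) / ((n : ℝ) + 1) ^ 2

open Filter Topology Finset

lemma hasDerivAt_log_Gamma {x : ℝ} (hx : 0 < x) :
    HasDerivAt (Real.log ∘ Real.Gamma) (digamma x) x := by
  have hd : DifferentiableAt ℝ Real.Gamma x := by
    refine Real.differentiableAt_Gamma fun m => ?_
    have : (0 : ℝ) ≤ m := m.cast_nonneg
    linarith
  exact hd.hasDerivAt.log (Real.Gamma_pos_of_pos hx).ne'

lemma log_Gamma_add_one {x : ℝ} (hx : 0 < x) :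
    Real.log (Real.Gamma (x + 1)) = Real.log (Real.Gamma x) + Real.log x := by
  rw [Real.Gamma_add_one hx.ne', Real.log_mul hx.ne' (Real.Gamma_pos_of_pos hx).ne', add_comm]

lemma digamma_add_one {x : ℝ} (hx : 0 < x) : digamma (x + 1) = digamma x + 1 / x := by
  have h1 : HasDerivAt (fun y => (Real.log ∘ Real.Gamma) (y + 1)) (digamma (x + 1)) x :=
    (hasDerivAt_log_Gamma (by linarith : 0 < x + 1)).comp_add_const x 1
  have h2 : HasDerivAt (fun y => (Real.log ∘ Real.Gamma) y + Real.log y) (digamma x + x⁻¹) x :=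
    (hasDerivAt_log_Gamma hx).add (Real.hasDerivAt_log hx.ne')
  rw [one_div]
  refine h1.unique (h2.congr_of_eventuallyEq ?_)
  filter_upwards [Ioi_mem_nhds hx] with y hy
  exact log_Gamma_add_one hy

lemma slope_log_Gamma {x : ℝ} (hx : 0 < x) :
    slope (Real.log ∘ Real.Gamma) x (x + 1) = Real.log x := by
  simp [slope_def_field, log_Gamma_add_one hx]

lemma digamma_le_log {x : ℝ} (hx : 0 < x) : digamma x ≤ Real.log x := by
  rw [← slope_log_Gamma hx]
  exact Real.convexOn_log_Gamma.le_slope_of_hasDerivAt hx (by simp; linarith) (by linarith)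
    (hasDerivAt_log_Gamma hx)

lemma log_sub_le_digamma {x : ℝ} (hx : 0 < x) : Real.log x - 1 / x ≤ digamma x := by
  have h : Real.log x ≤ digamma (x + 1) := by
    rw [← slope_log_Gamma hx]
    exact Real.convexOn_log_Gamma.slope_le_of_hasDerivAt hx (by simp; linarith) (by linarith)
      (hasDerivAt_log_Gamma (by linarith))
  rw [digamma_add_one hx] at h
  linarith

lemma digamma_add_natCast {x : ℝ} (hx : 0 < x) (n : ℕ) :
    digamma (x + n) = digamma x + ∑ m ∈ range n, 1 / (x + m) := by
  induction n with
  | zero => simp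
  | succ n ih =>
    rw [sum_range_succ, ← add_assoc, ← ih, Nat.cast_succ, ← add_assoc,
      digamma_add_one (by positivity)]

lemma summable_herglotzF {x : ℝ} (hx : 0 < x) :
    Summable fun n : ℕ =>
      (digamma (((n : ℝ) + 1) * x) - Real.log (((n : ℝ) + 1) * x)) / ((n : ℝ) + 1) := by
  have hs : Summable fun n : ℕ => x⁻¹ * (1 / ((n + 1 : ℕ) : ℝ) ^ 2) :=
    ((summable_nat_add_iff 1).2 (Real.summable_one_div_nat_pow.2 one_lt_two)).mul_left _
  refine hs.of_norm_bounded fun n => ?_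
  have hn : (0 : ℝ) < n + 1 := by positivity
  have hnx : 0 < ((n : ℝ) + 1) * x := by positivity
  have h1 := digamma_le_log hnx
  have h2 := log_sub_le_digamma hnx
  rw [Real.norm_eq_abs, abs_div, abs_of_pos hn, div_le_iff₀ hn]
  have : x⁻¹ * (1 / ((n + 1 : ℕ) : ℝ) ^ 2) * (n + 1) = 1 / ((n + 1) * x) := by
    push_cast
    field_simp
  rw [this, abs_le]
  constructor
  · linarith
  · have : 0 < 1 / (((n : ℝ) + 1) * x) := by positivity
    linarith

lemma mul_pow_le_add_one_pow_sub (k : ℕ) {a : ℝ} (ha : 0 ≤ a) :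
    (k + 1) * a ^ k ≤ (a + 1) ^ (k + 1) - a ^ (k + 1) := by
  induction k with
  | zero => simp
  | succ k ih =>
    have h := mul_le_mul_of_nonneg_left ih (by linarith : 0 ≤ a + 1)
    have h' : 0 ≤ a ^ k := by positivity
    have h'' : 0 ≤ (k : ℝ) * a ^ k := by positivity
    push_cast
    ring_nf at h ⊢
    nlinarith

lemma add_one_pow_sub_le_mul_pow (k : ℕ) {a : ℝ} (ha : 0 ≤ a) :
    (a + 1) ^ (k + 1) - a ^ (k + 1) ≤ (k + 1) * (a + 1) ^ k := by
  induction k with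
  | zero => simp
  | succ k ih =>
    have h := mul_le_mul_of_nonneg_left ih ha
    have h' : 0 ≤ (k + 1) * (a + 1) ^ k := by positivity
    push_cast
    have e1 : (a + 1) ^ (k + 1 + 1) - a ^ (k + 1 + 1) =
      a * ((a + 1) ^ (k + 1) - a ^ (k + 1)) + (a + 1) ^ (k + 1) := by ring
    have e2 : ((k : ℝ) + 1 + 1) * (a + 1) ^ (k + 1) =
      a * ((k + 1) * (a + 1) ^ k) + (k + 1) * (a + 1) ^ k + (a + 1) ^ (k + 1) := by ring
    linarith

lemma mul_sum_pow_le (k L : ℕ) :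
    (k + 1) * ∑ n ∈ range L, ((n : ℝ) + 1) ^ k ≤ ((L : ℝ) + 1) ^ (k + 1) := by
  induction L with
  | zero => simp
  | succ L ih =>
    have := mul_pow_le_add_one_pow_sub k (by positivity : (0 : ℝ) ≤ L + 1)
    rw [sum_range_succ, mul_add]
    push_cast
    linarith

lemma pow_le_mul_sum_pow (k L : ℕ) :
    (L : ℝ) ^ (k + 1) ≤ (k + 1) * ∑ n ∈ range L, ((n : ℝ) + 1) ^ k := by
  induction L with
  | zero => simp
  | succ L ih =>
    have := add_one_pow_sub_le_mul_pow k (by positivity : (0 : ℝ) ≤ L)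
    rw [sum_range_succ, mul_add]
    push_cast
    linarith

lemma sum_pow_div_le (k L : ℕ) :
    (∑ n ∈ range L, ((n : ℝ) + 1) ^ k) / ((L : ℝ) + 1) ^ (k + 1) ≤ 1 / ((k : ℝ) + 1) := by
  rw [div_le_div_iff₀ (by positivity) (by positivity)]
  have := mul_sum_pow_le k L
  linarith

lemma tendsto_sum_pow_div (k : ℕ) :
    Tendsto (fun L : ℕ => (∑ n ∈ range L, ((n : ℝ) + 1) ^ k) / ((L : ℝ) + 1) ^ (k + 1))
      atTop (𝓝 (1 / ((k : ℝ) + 1))) := by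
  have hlow : Tendsto (fun L : ℕ => 1 / ((k : ℝ) + 1) - 1 / ((L : ℝ) + 1)) atTop
      (𝓝 (1 / ((k : ℝ) + 1))) := by
    simpa using tendsto_const_nhds.sub (tendsto_one_div_add_atTop_nhds_zero_nat (𝕜 := ℝ))
  refine tendsto_of_tendsto_of_tendsto_of_le_of_le hlow tendsto_const_nhds (fun L => ?_)
    (sum_pow_div_le k)
  have h := pow_le_mul_sum_pow k (L + 1)
  rw [sum_range_succ] at h
  push_cast at h
  have hL : (0 : ℝ) < L + 1 := by positivity
  have e : (1 : ℝ) / (L + 1) = (L + 1) ^ k / (L + 1) ^ (k + 1) := by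
    rw [pow_succ]
    field_simp
  change 1 / ((k : ℝ) + 1) - 1 / ((L : ℝ) + 1) ≤ _
  rw [e, sub_le_iff_le_add, ← add_div, div_le_div_iff₀ (by positivity) (by positivity)]
  linarith

lemma tendsto_sum_neg_log {q : ℝ} (hq0 : 0 < q) (hq1 : q < 1) :
    Tendsto (fun L : ℕ => ∑ n ∈ range L,
      1 / ((n : ℝ) + 1) * -Real.log (1 - ((n : ℝ) + 1) * q / ((L : ℝ) + 1))) atTop
      (𝓝 (Li2 q)) := by
  have key : ∀ L : ℕ, ∑ n ∈ range L,
      1 / ((n : ℝ) + 1) * -Real.log (1 - ((n : ℝ) + 1) * q / ((L : ℝ) + 1)) =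
      ∑' k : ℕ, q ^ (k + 1) / ((k : ℝ) + 1) *
        ((∑ n ∈ range L, ((n : ℝ) + 1) ^ k) / ((L : ℝ) + 1) ^ (k + 1)) := by
    intro L
    refine (HasSum.tsum_eq ?_).symm
    have hL : (0 : ℝ) < L + 1 := by positivity
    have h : ∀ n ∈ range L, HasSum (fun k : ℕ => 1 / ((n : ℝ) + 1) *
        ((((n : ℝ) + 1) * q / ((L : ℝ) + 1)) ^ (k + 1) / ((k : ℝ) + 1)))
        (1 / ((n : ℝ) + 1) * -Real.log (1 - ((n : ℝ) + 1) * q / ((L : ℝ) + 1))) := by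
      intro n hn
      refine (Real.hasSum_pow_div_log_of_abs_lt_one ?_).mul_left _
      have hnL : (n : ℝ) < L := by exact_mod_cast mem_range.1 hn
      rw [abs_of_nonneg (by positivity), div_lt_one hL]
      nlinarith [(n.cast_nonneg : (0 : ℝ) ≤ n)]
    convert hasSum_sum h using 2 with k
    rw [sum_div, mul_sum]
    refine sum_congr rfl fun n _ => ?_
    rw [div_pow, mul_pow, pow_succ ((n : ℝ) + 1)]
    field_simp
  simp_rw [key]
  have hlim : Li2 q = ∑' k : ℕ, q ^ (k + 1) / ((k : ℝ) + 1) * (1 / ((k : ℝ) + 1)) := by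
    unfold Li2
    congr 1
    ext k
    field_simp
  rw [hlim]
  refine tendsto_tsum_of_dominated_convergence (bound := fun k => q ^ (k + 1)) ?_
    (fun k => (tendsto_sum_pow_div k).const_mul _) (Eventually.of_forall fun L k => ?_)
  · exact (summable_nat_add_iff 1).2 (summable_geometric_of_lt_one hq0.le hq1)
  · have h1 : 1 / ((k : ℝ) + 1) ≤ 1 := by
      rw [div_le_one (by positivity)]
      linarith [(k.cast_nonneg : (0 : ℝ) ≤ k)]
    have h2 := (sum_pow_div_le k L).trans h1
    rw [Real.norm_of_nonneg (by positivity)]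
    have h3 : q ^ (k + 1) / ((k : ℝ) + 1) ≤ q ^ (k + 1) := by
      rw [div_eq_mul_one_div]
      exact mul_le_of_le_one_right (by positivity) h1
    calc _ ≤ q ^ (k + 1) * 1 := mul_le_mul h3 h2 (by positivity) (by positivity)
      _ = _ := mul_one _

lemma abs_digamma_sub_digamma_add_log_le {a b : ℝ} (hb : 0 < b) (hba : b ≤ a) :
    |digamma a - digamma b - -Real.log (b / a)| ≤ 1 / b := by
  have ha := hb.trans_le hba
  have h1 := digamma_le_log ha
  have h2 := log_sub_le_digamma ha
  have h3 := digamma_le_log hb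
  have h4 := log_sub_le_digamma hb
  have h5 : 1 / a ≤ 1 / b := one_div_le_one_div_of_le hb hba
  rw [Real.log_div hb.ne' ha.ne', abs_le]
  constructor <;> linarith

lemma tendsto_sum_digamma_sub {q : ℝ} (hq0 : 0 < q) (hq1 : q < 1) :
    Tendsto (fun L : ℕ => ∑ n ∈ range L, 1 / ((n : ℝ) + 1) *
      (digamma ((L : ℝ) + 1) - digamma ((L : ℝ) + 1 - ((n : ℝ) + 1) * q))) atTop
      (𝓝 (Li2 q)) := by
  have hz : Tendsto (fun L : ℕ => 1 / (1 - q) *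
      ((L : ℝ)⁻¹ * ∑ n ∈ range L, 1 / ((n : ℝ) + 1))) atTop (𝓝 0) := by
    simpa using (tendsto_one_div_add_atTop_nhds_zero_nat (𝕜 := ℝ)).cesaro.const_mul (1 / (1 - q))
  have hdiff := squeeze_zero_norm (a := fun L : ℕ => 1 / (1 - q) *
      ((L : ℝ)⁻¹ * ∑ n ∈ range L, 1 / ((n : ℝ) + 1))) (f := fun L : ℕ =>
      (∑ n ∈ range L, 1 / ((n : ℝ) + 1) *
        (digamma ((L : ℝ) + 1) - digamma ((L : ℝ) + 1 - ((n : ℝ) + 1) * q))) -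
      ∑ n ∈ range L,
        1 / ((n : ℝ) + 1) * -Real.log (1 - ((n : ℝ) + 1) * q / ((L : ℝ) + 1))) ?_ hz
  · simpa using hdiff.add (tendsto_sum_neg_log hq0 hq1)
  intro L
  rw [← sum_sub_distrib, ← mul_assoc, mul_sum]
  refine (norm_sum_le _ _).trans (sum_le_sum fun n hn => ?_)
  have hnL : (n : ℝ) + 1 ≤ L := by exact_mod_cast mem_range.1 hn
  have hn0 : (0 : ℝ) ≤ n := n.cast_nonneg
  have hL : (0 : ℝ) < L := by linarith
  have hq : 0 < 1 - q := by linarith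
  have hb : L * (1 - q) ≤ (L : ℝ) + 1 - ((n : ℝ) + 1) * q := by nlinarith
  have hb0 : 0 < L * (1 - q) := by positivity
  have h := abs_digamma_sub_digamma_add_log_le (hb0.trans_le hb)
    (by nlinarith : (L : ℝ) + 1 - ((n : ℝ) + 1) * q ≤ L + 1)
  rw [sub_div, div_self (by positivity)] at h
  rw [← mul_sub, norm_mul, Real.norm_of_nonneg (by positivity : 0 ≤ 1 / ((n : ℝ) + 1)), mul_comm]
  refine mul_le_mul_of_nonneg_right (h.trans ((one_div_le_one_div_of_le hb0 hb).trans_eq ?_))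
    (by positivity)
  field_simp

lemma sum_digamma_eq {x : ℝ} (hx : 0 < x) (L : ℕ) :
    ∑ n ∈ range L, 1 / ((n : ℝ) + 1) * (digamma ((n : ℝ) + 1)
      - digamma (((n : ℝ) + 1) * (x / (x + 1)))
      - ∑ m ∈ range (n + 1), 1 / (((n : ℝ) + 1) * x + m)) =
    ∑ n ∈ range L, 1 / ((n : ℝ) + 1) *
      (digamma ((L : ℝ) + 1) - digamma ((L : ℝ) + 1 - ((n : ℝ) + 1) * (1 / (1 + x)))) := by
  induction L with
  | zero => simp
  | succ L ih =>
    have hx1 : 0 < 1 + x := by linarith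
    have hpos : ∀ n ∈ range (L + 1), 0 < ((L : ℝ) + 1) * (1 + x) - (n + 1) := by
      intro n hn
      have : (n : ℝ) + 1 ≤ L + 1 := by exact_mod_cast mem_range.1 hn
      have : 0 < ((L : ℝ) + 1) * x := by positivity
      linarith
    have hsub : ∀ n : ℕ, (L : ℝ) + 1 - ((n : ℝ) + 1) * (1 / (1 + x)) =
        (((L : ℝ) + 1) * (1 + x) - (n + 1)) / (1 + x) := by
      intro n
      field_simp
    have hstep : ∀ n ∈ range (L + 1), 1 / ((n : ℝ) + 1) * (digamma (((L + 1 : ℕ) : ℝ) + 1)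
        - digamma (((L + 1 : ℕ) : ℝ) + 1 - ((n : ℝ) + 1) * (1 / (1 + x)))) =
        1 / ((n : ℝ) + 1) * (digamma ((L : ℝ) + 1)
          - digamma ((L : ℝ) + 1 - ((n : ℝ) + 1) * (1 / (1 + x))))
        - 1 / ((L : ℝ) + 1) * (1 / (((L : ℝ) + 1) * (1 + x) - (n + 1))) := by
      intro n hn
      have hp := hpos n hn
      have e : ((L + 1 : ℕ) : ℝ) + 1 - ((n : ℝ) + 1) * (1 / (1 + x)) =
          ((L : ℝ) + 1 - ((n : ℝ) + 1) * (1 / (1 + x))) + 1 := by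
        push_cast
        ring
      have hL : (0 : ℝ) < L + 1 := by positivity
      have hn0 : (0 : ℝ) < n + 1 := by positivity
      have hp' : 0 < (L : ℝ) + 1 - ((n : ℝ) + 1) * (1 / (1 + x)) := by
        rw [hsub]
        positivity
      rw [e, Nat.cast_succ, digamma_add_one hL, digamma_add_one hp']
      have e2 : 1 / ((n : ℝ) + 1) *
          (1 / ((L : ℝ) + 1) - 1 / ((L : ℝ) + 1 - ((n : ℝ) + 1) * (1 / (1 + x)))) =
          - (1 / ((L : ℝ) + 1) * (1 / (((L : ℝ) + 1) * (1 + x) - (n + 1)))) := by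
        rw [hsub]
        have := hp.ne'
        field_simp
        ring
      linear_combination e2
    have hrefl : ∑ m ∈ range (L + 1), 1 / (((L : ℝ) + 1) * x + m) =
        ∑ n ∈ range (L + 1), 1 / (((L : ℝ) + 1) * (1 + x) - (n + 1)) := by
      rw [← sum_range_reflect]
      refine sum_congr rfl fun n hn => ?_
      have : n ≤ L := Nat.lt_succ_iff.1 (mem_range.1 hn)
      rw [show L + 1 - 1 - n = L - n by omega, Nat.cast_sub this]
      congr 1
      ring
    have hlast : (L : ℝ) + 1 - ((L : ℝ) + 1) * (1 / (1 + x)) = ((L : ℝ) + 1) * (x / (x + 1)) := by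
      field_simp
      ring
    rw [sum_congr rfl hstep, sum_sub_distrib, ← mul_sum, ← hrefl, sum_range_succ, ih,
      sum_range_succ (fun n : ℕ => 1 / ((n : ℝ) + 1) * (digamma ((L : ℝ) + 1)
          - digamma ((L : ℝ) + 1 - ((n : ℝ) + 1) * (1 / (1 + x))))), hlast]
    ring

theorem herglotzF_three_term (x : ℝ) (hx : 0 < x) :
    herglotzF x - herglotzF (x + 1) - herglotzF (x / (x + 1)) =
      -herglotzF 1 + Li2 (1 / (1 + x)) := by
  have hx1 : 0 < x + 1 := by linarith
  have hy : 0 < x / (x + 1) := by positivity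
  have hS := (((summable_herglotzF hx).hasSum.sub (summable_herglotzF hx1).hasSum).sub
    (summable_herglotzF hy).hasSum).add (summable_herglotzF one_pos).hasSum
  have hterm : ∀ n : ℕ, (digamma (((n : ℝ) + 1) * x) - Real.log (((n : ℝ) + 1) * x)) / ((n : ℝ) + 1)
      - (digamma (((n : ℝ) + 1) * (x + 1)) - Real.log (((n : ℝ) + 1) * (x + 1))) / ((n : ℝ) + 1)
      - (digamma (((n : ℝ) + 1) * (x / (x + 1))) - Real.log (((n : ℝ) + 1) * (x / (x + 1))))
        / ((n : ℝ) + 1)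
      + (digamma (((n : ℝ) + 1) * 1) - Real.log (((n : ℝ) + 1) * 1)) / ((n : ℝ) + 1) =
      1 / ((n : ℝ) + 1) * (digamma ((n : ℝ) + 1)
      - digamma (((n : ℝ) + 1) * (x / (x + 1)))
      - ∑ m ∈ range (n + 1), 1 / (((n : ℝ) + 1) * x + m)) := by
    intro n
    have hn : (0 : ℝ) < n + 1 := by positivity
    have h := digamma_add_natCast (by positivity : 0 < ((n : ℝ) + 1) * x) (n + 1)
    rw [show ((n : ℝ) + 1) * x + ((n + 1 : ℕ) : ℝ) = ((n : ℝ) + 1) * (x + 1) by push_cast; ring] at h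
    rw [h, Real.log_mul hn.ne' hx.ne', Real.log_mul hn.ne' hx1.ne', Real.log_mul hn.ne' hy.ne',
      Real.log_div hx.ne' hx1.ne', mul_one]
    ring
  simp_rw [hterm] at hS
  have hlim := hS.tendsto_sum_nat
  simp_rw [sum_digamma_eq hx] at hlim
  have hq1 : 1 / (1 + x) < 1 := by
    rw [div_lt_one (by linarith)]
    linarith
  have := tendsto_nhds_unique hlim (tendsto_sum_digamma_sub (by positivity) hq1)
  simp only [herglotzF]
  linarith
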